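/- arXiv:2409.01370 — 2 statements merged into one kernel-verified Lean document; each statement's English description precedes it below -/
import Mathlib

section
/- Let c be a Čech closure operator on a type Y and let a ∈ Y be a point whose only neighborhood is Y itself, i.e., for every U ⊆ Y, if a ∈ i_c(U) then U = Y. Define H : Y × [0,1] → Y by H(y,t) = y for t < 1 and H(y,1) = a. Then H is continuous with respect to the product closure operator e on Y × [0,1], i.e., H(e(B)) ⊆ c(H(B)) for every B ⊆ Y × [0,1]. Since H(·,0) = id_Y and H(·,1) is the constant map at a, the closure space (Y,c) is contractible. -/
/-- A Čech closure operator on `Y`. -/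
def IsCechClosure {Y : Type*} (c : Set Y → Set Y) : Prop :=
  c ∅ = ∅ ∧ (∀ A : Set Y, A ⊆ c A) ∧ (∀ A B : Set Y, c (A ∪ B) = c A ∪ c B)

/-- The interior operator associated to a closure operator: `i_c(A) = (c(Aᶜ))ᶜ`. -/
def intOp {Y : Type*} (c : Set Y → Set Y) (A : Set Y) : Set Y := (c Aᶜ)ᶜ

/-- The product closure operator on `Y × [0,1]` built from a closure operator `c`
on `Y` and the Euclidean topology on `[0,1]`: `(y,t) ∈ e(B)` iff every product of
a `c`-neighborhood of `y` with a topological neighborhood of `t` meets `B`. -/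
def prodCl {Y : Type*} (c : Set Y → Set Y) (B : Set (Y × unitInterval)) :
    Set (Y × unitInterval) :=
  {p | ∀ U : Set Y, p.1 ∈ intOp c U → ∀ V : Set unitInterval, p.2 ∈ interior V →
      ((U ×ˢ V) ∩ B).Nonempty}

/-- If `univ` is the only neighborhood of `a`, then `a` lies in the closure of every nonempty set. -/
theorem mem_closure_of_nonempty_of_only_neighborhood_univ {Y : Type*} {c : Set Y → Set Y} {a : Y}
    (ha : ∀ U : Set Y, a ∈ intOp c U → U = Set.univ) {A : Set Y} (hA : A.Nonempty) : a ∈ c A := by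
  by_contra h
  exact hA.ne_empty (Set.compl_univ_iff.mp (ha Aᶜ (by simpa [intOp] using h)))

/-- A set whose product closure is inhabited is nonempty. -/
theorem nonempty_of_mem_prodCl {Y : Type*} {c : Set Y → Set Y} (hc : c ∅ = ∅)
    {B : Set (Y × unitInterval)} {p : Y × unitInterval} (hp : p ∈ prodCl c B) : B.Nonempty :=
  (hp Set.univ (by simp [intOp, hc]) Set.univ (by simp)).mono Set.inter_subset_right

/-- If `a ∈ Y` has the whole space as its only neighborhood, then the homotopy
`H(y,t) = y` for `t < 1`, `H(y,1) = a` is continuous from `(Y × [0,1], e)` to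
`(Y, c)`; since `H(·,0) = id` and `H(·,1)` is constant at `a`, the closure space
`(Y, c)` is contractible. -/
theorem contractible_of_only_neighborhood_univ {Y : Type*}
    (c : Set Y → Set Y) (hc : IsCechClosure c) (a : Y)
    (ha : ∀ U : Set Y, a ∈ intOp c U → U = Set.univ)
    (H : Y × unitInterval → Y)
    (hH₁ : ∀ (y : Y) (t : unitInterval), t ≠ 1 → H (y, t) = y)
    (hH₂ : ∀ y : Y, H (y, 1) = a) :
    ∀ B : Set (Y × unitInterval), H '' prodCl c B ⊆ c (H '' B) := by
  rintro B _ ⟨⟨y, t⟩, hp, rfl⟩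
  by_cases ht : t = 1
  · subst ht
    rw [hH₂]
    exact mem_closure_of_nonempty_of_only_neighborhood_univ ha
      ((nonempty_of_mem_prodCl hc.1 hp).image H)
  · rw [hH₁ y t ht]
    by_contra hy
    obtain ⟨⟨u, v⟩, ⟨hu, hv⟩, huv⟩ := hp (H '' B)ᶜ (by simpa [intOp] using hy) {1}ᶜ
      (by rw [isOpen_compl_singleton.interior_eq]; exact ht)
    exact hu ⟨(u, v), huv, hH₁ u v hv⟩
end

section
/- Let E be a reflexive relation on a type X, let x ∈ X, let U_x = {y ∈ X | y E x}, and let c' be the subspace closure operator on U_x induced by c_E, i.e., c'(S) = U_x ∩ c_E(S) for S ⊆ U_x, where c_E(A) = {y | ∃ z ∈ A, z E y}. Then the map H : U_x × [0,1] → U_x given by H(y,t) = y for t < 1 and H(y,1) = x is continuous with respect to the product closure operator on U_x × [0,1] built from c' and the Euclidean topology on [0,1]; since H(·,0) = id and H(·,1) is constant at x, the closure space (U_x, c') is contractible. -/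
/-- The closure operator associated to a relation `E` on `X`:
`c_E(A) = {y | ∃ z ∈ A, z E y}`. -/
def cE {X : Type*} (E : X → X → Prop) (A : Set X) : Set X := {y | ∃ z ∈ A, E z y}

/-- For a reflexive relation `E` on `X`, `x ∈ X`, and `U_x = {y | y E x}` with the
subspace closure `c'(S) = U_x ∩ c_E(S)`, the homotopy `H(y,t) = y` for `t < 1`,
`H(y,1) = x` is continuous from `(U_x × [0,1])` (with the product closure of `c'`
and the Euclidean topology) to `(U_x, c')`; since `H(·,0) = id` and `H(·,1)` is
constant at `x`, the closure space `(U_x, c')` is contractible. -/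
theorem Ux_contractible {X : Type*} (E : X → X → Prop) (hE : Reflexive E) (x : X)
    (c' : Set {y : X // E y x} → Set {y : X // E y x})
    (hc' : ∀ S : Set {y : X // E y x},
        c' S = Subtype.val ⁻¹' cE E (Subtype.val '' S))
    (H : {y : X // E y x} × unitInterval → {y : X // E y x})
    (hH₁ : ∀ (y : {y : X // E y x}) (t : unitInterval), t ≠ 1 → H (y, t) = y)
    (hH₂ : ∀ y : {y : X // E y x}, H (y, 1) = ⟨x, hE x⟩) :
    ∀ B : Set ({y : X // E y x} × unitInterval),
      H '' prodCl c' B ⊆ c' (H '' B) := by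
  rintro B _ ⟨⟨y, t⟩, hp, rfl⟩
  rw [hc']
  by_cases ht : t = 1
  · subst ht
    obtain ⟨q, -, hq⟩ := hp Set.univ (by simp [intOp, hc', cE]) Set.univ (by simp)
    refine ⟨(H q : X), ⟨H q, ⟨q, hq, rfl⟩, rfl⟩, ?_⟩
    rw [hH₂]
    exact (H q).2
  · have hU : y ∈ intOp c' {z | E z y} := by
      intro h
      rw [hc'] at h
      obtain ⟨_, ⟨z, hz, rfl⟩, hzy⟩ := h
      exact hz hzy
    have hV : t ∈ interior ({1}ᶜ : Set unitInterval) := by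
      rw [isOpen_compl_singleton.interior_eq]
      exact ht
    obtain ⟨⟨z, s⟩, ⟨hz, hs⟩, hB⟩ := hp _ hU _ hV
    refine ⟨z, ⟨z, ⟨(z, s), hB, hH₁ z s hs⟩, rfl⟩, ?_⟩
    rw [hH₁ y t ht]
    exact hz
end
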